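/- arXiv:1606.03645 — 5 statements merged into one kernel-verified Lean document; each statement's English description precedes it below -/
import Mathlib

section
/- For ρ ∈ [−1,1], the integral ∫_c^∞ f_ρ(y) dy is finite if and only if ρ > 0. Equivalently, the scale function value s̃(∞) = A₂ ∫_c^∞ f_ρ(y) dy is infinite exactly for ρ ∈ [−1,0] and finite exactly for ρ ∈ (0,1]. -/
open MeasureTheory Real Set

/-- For ρ ∈ [−1,1], ∫_c^∞ f_ρ(y) dy is finite (i.e. f_ρ is integrable on [c,∞)) iff ρ > 0. -/
theorem stmt_2 (α β m c ρ : ℝ) (hα : 0 < α) (hβ : 0 < β) (hm : 0 < m) (hc : 0 < c)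
    (hρ₁ : -1 ≤ ρ) (hρ₂ : ρ ≤ 1) :
    IntegrableOn
      (fun y => Real.exp (α / β ^ 2 * (y - m) ^ 2 - 2 * ρ / β * Real.exp y)) (Ici c)
      ↔ 0 < ρ := by
  have hA : 0 < α / β ^ 2 := by positivity
  constructor
  · intro h
    by_contra hρ
    have hρ' : ρ ≤ 0 := not_lt.mp hρ
    have hB : 2 * ρ / β ≤ 0 := div_nonpos_of_nonpos_of_nonneg (by linarith) hβ.le
    have h1 : IntegrableOn (fun _ : ℝ => (1 : ℝ)) (Ici c) := by
      refine Integrable.mono h (by fun_prop) (Filter.Eventually.of_forall fun y => ?_)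
      rw [norm_one, Real.norm_eq_abs, abs_of_pos (Real.exp_pos _)]
      apply Real.one_le_exp
      have h2 : 0 ≤ α / β ^ 2 * (y - m) ^ 2 := by positivity
      have h3 := mul_nonpos_of_nonpos_of_nonneg hB (Real.exp_pos y).le
      linarith
    rw [integrableOn_const_iff] at h1
    simp at h1
  · intro hρ
    have hB : 0 < 2 * ρ / β := by positivity
    rw [integrableOn_Ici_iff_integrableOn_Ioi]
    refine integrable_of_isBigO_exp_neg (b := 1) one_pos (by fun_prop) ?_
    generalize α / β ^ 2 = A at hA ⊢
    generalize 2 * ρ / β = B at hB ⊢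
    apply Asymptotics.IsBigO.of_bound 1
    filter_upwards [Filter.eventually_ge_atTop 1, Filter.eventually_ge_atTop m,
      Filter.eventually_ge_atTop (6 * (A + 1) / B)] with y h1 h2 h3
    rw [one_mul, Real.norm_eq_abs, Real.norm_eq_abs, abs_of_pos (Real.exp_pos _),
      abs_of_pos (Real.exp_pos _), Real.exp_le_exp]
    rw [div_le_iff₀ hB] at h3
    have h4 := Real.pow_div_factorial_le_exp y (by linarith) 3
    norm_num [Nat.factorial] at h4
    have h5 := mul_le_mul_of_nonneg_left h4 hB.le
    have h6 : (y - m) ^ 2 ≤ y ^ 2 := by nlinarith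
    have h7 := mul_le_mul_of_nonneg_left h6 hA.le
    have h8 := mul_le_mul_of_nonneg_right h3 (sq_nonneg y)
    nlinarith
end

section
/- Let ρ ∈ (0,1]. Then lim_{y→+∞} (∫_y^∞ f_ρ(z) dz) / (e^{−y} f_ρ(y)) = β/(2ρ); in particular, ∫_y^∞ f_ρ(z) dz is asymptotically equivalent to (β/(2ρ)) e^{−y} f_ρ(y) as y → +∞. -/
open MeasureTheory Real Filter Set

lemma aux_poly (a b c : ℝ) :
    Tendsto (fun x : ℝ => (a * x ^ 2 + b * x + c) * Real.exp (-x)) atTop (nhds 0) := by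
  have h2 := (tendsto_pow_mul_exp_neg_atTop_nhds_zero 2).const_mul a
  have h1 := (tendsto_pow_mul_exp_neg_atTop_nhds_zero 1).const_mul b
  have h0 := (tendsto_pow_mul_exp_neg_atTop_nhds_zero 0).const_mul c
  have h := (h2.add h1).add h0
  simp only [mul_zero, add_zero] at h
  refine h.congr fun x => ?_
  ring

lemma aux_bot (a b c K : ℝ) (hK : 0 < K) :
    Tendsto (fun x : ℝ => (a * x ^ 2 + b * x + c) - K * Real.exp x) atTop atBot := by
  have h := (aux_poly a b c).sub_const K
  have h' := Real.tendsto_exp_atTop.atTop_mul_neg (by linarith : (0:ℝ) - K < 0) h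
  refine h'.congr fun x => ?_
  have : Real.exp x * Real.exp (-x) = 1 := by rw [← Real.exp_add]; simp
  linear_combination (a * x ^ 2 + b * x + c) * this

/-- For ρ ∈ (0,1], (∫_y^∞ f_ρ(z) dz) / (e^{−y} f_ρ(y)) → β/(2ρ) as y → +∞. -/
theorem stmt_4 (α β m ρ : ℝ) (hα : 0 < α) (hβ : 0 < β) (hm : 0 < m)
    (hρ₁ : 0 < ρ) (hρ₂ : ρ ≤ 1) :
    Tendsto (fun y =>
        (∫ z in Ici y, Real.exp (α / β ^ 2 * (z - m) ^ 2 - 2 * ρ / β * Real.exp z)) /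
          (Real.exp (-y) * Real.exp (α / β ^ 2 * (y - m) ^ 2 - 2 * ρ / β * Real.exp y)))
      atTop (nhds (β / (2 * ρ))) := by
  have hK : 0 < 2 * ρ / β := by positivity
  have hlim : β / (2 * ρ) = (2 * ρ / β)⁻¹ := by rw [inv_div]
  rw [hlim]
  generalize 2 * ρ / β = K at *
  generalize α / β ^ 2 = A at *
  set f : ℝ → ℝ := fun z => Real.exp (A * (z - m) ^ 2 - K * Real.exp z) with hf
  have hfc : Continuous f := by fun_prop
  have hfpos : ∀ x, 0 < f x := fun x => Real.exp_pos _
  have hO : f =O[atTop] fun x => Real.exp (-1 * x) := by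
    refine Asymptotics.IsBigO.of_bound 1 ?_
    filter_upwards [(aux_bot A (-2 * A * m + 1) (A * m ^ 2) K hK).eventually_le_atBot 0] with x hx
    rw [Real.norm_of_nonneg (hfpos x).le, Real.norm_of_nonneg (Real.exp_pos _).le, one_mul]
    apply Real.exp_le_exp.2
    nlinarith
  have hint : ∀ y, IntegrableOn f (Ioi y) := fun y =>
    integrable_of_isBigO_exp_neg one_pos hfc.continuousOn hO
  have hF : ∀ y, ∫ z in Ici y, f z = (∫ z in Ioi 0, f z) - ∫ z in (0:ℝ)..y, f z := by
    intro y
    rw [integral_Ici_eq_integral_Ioi, ← intervalIntegral.integral_Ioi_sub_Ioi' (hint 0) (hint y)]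
    ring
  change Tendsto (fun y => (∫ z in Ici y, f z) / (Real.exp (-y) * f y)) atTop (nhds K⁻¹)
  simp_rw [hF]
  have hden : Tendsto (fun y => K - (0 * y ^ 2 + 2 * A * y + (-2 * A * m - 1)) * Real.exp (-y))
      atTop (nhds K) := by
    simpa using (aux_poly 0 (2 * A) (-2 * A * m - 1)).const_sub K
  have hfd : ∀ y, HasDerivAt (fun y => Real.exp (-y) * f y)
      (-f y * (K - (0 * y ^ 2 + 2 * A * y + (-2 * A * m - 1)) * Real.exp (-y))) y := by
    intro y
    have h1 : HasDerivAt (fun y : ℝ => Real.exp (-y)) (Real.exp (-y) * -1) y :=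
      (hasDerivAt_neg y).exp
    have h2 : HasDerivAt f (f y * (A * (2 * (y - m)) - K * Real.exp y)) y := by
      have h3 := ((((hasDerivAt_id y).sub_const m).pow 2).const_mul A).sub
        ((Real.hasDerivAt_exp y).const_mul K)
      have h4 : HasDerivAt f _ y := h3.exp
      refine h4.congr_deriv ?_
      simp [hf]
    have h5 : HasDerivAt (fun y => Real.exp (-y) * f y) _ y := h1.mul h2
    refine h5.congr_deriv ?_
    have : Real.exp y * Real.exp (-y) = 1 := by rw [← Real.exp_add]; simp
    linear_combination (-K * f y) * this
  refine HasDerivAt.lhopital_zero_atTop (f' := fun y => - f y) (Eventually.of_forall fun y => ?_)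
    (Eventually.of_forall hfd) ?_ ?_ ?_ ?_
  · exact (hfc.integral_hasStrictDerivAt 0 y).hasDerivAt.const_sub _
  · filter_upwards [hden.eventually_ne hK.ne'] with y hy
    exact mul_ne_zero (neg_ne_zero.2 (hfpos y).ne') hy
  · simpa using (intervalIntegral_tendsto_integral_Ioi 0 (hint 0) tendsto_id).const_sub
      (∫ z in Ioi 0, f z)
  · refine (Real.tendsto_exp_atBot.comp
      (aux_bot A (-2 * A * m - 1) (A * m ^ 2) K hK)).congr fun x => ?_
    simp only [hf, Function.comp, ← Real.exp_add]
    congr 1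
    ring
  · refine (hden.inv₀ hK.ne').congr fun y => ?_
    have := (hfpos y).ne'
    rw [div_mul_eq_div_div, div_self (neg_ne_zero.2 this), one_div]
end

section
/- Let ρ ∈ (0,1] and c > 0. Then there exists M > c such that for all y > M one has ∫_y^∞ f_ρ(z) dz ≤ (β/ρ) e^{−y} f_ρ(y), and there exists M' > c such that for all y > M' one has ∫_y^∞ f_ρ(z) dz ≥ (β/(4ρ)) e^{−y} f_ρ(y). -/
open MeasureTheory Real Set

lemma aux (a k m : ℝ) (hk : 0 < k) : ∃ N : ℝ, ∀ y > N,
    (∫ z in Ici y, Real.exp (a * (z - m) ^ 2 - k * Real.exp z)) ≤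
        2 / k * (Real.exp (-y) * Real.exp (a * (y - m) ^ 2 - k * Real.exp y)) ∧
    1 / (2 * k) * (Real.exp (-y) * Real.exp (a * (y - m) ^ 2 - k * Real.exp y)) ≤
      ∫ z in Ici y, Real.exp (a * (z - m) ^ 2 - k * Real.exp z) := by
  have t2 := Real.tendsto_pow_mul_exp_neg_atTop_nhds_zero 2
  have t1 := Real.tendsto_pow_mul_exp_neg_atTop_nhds_zero 1
  have t0 := Real.tendsto_pow_mul_exp_neg_atTop_nhds_zero 0
  have T2 : Filter.Tendsto (fun y : ℝ => a * (y - m) ^ 2 * Real.exp (-y)) Filter.atTop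
      (nhds 0) := by
    have := ((t2.const_mul a).add (t1.const_mul (-2 * a * m))).add (t0.const_mul (a * m ^ 2))
    simp only [mul_zero, add_zero] at this
    refine this.congr fun y => ?_
    ring
  have T1 : Filter.Tendsto (fun y : ℝ => (2 * a * (y - m) - 1) * Real.exp (-y)) Filter.atTop
      (nhds 0) := by
    have := (t1.const_mul (2 * a)).add (t0.const_mul (-2 * a * m - 1))
    simp only [mul_zero, add_zero] at this
    refine this.congr fun y => ?_
    ring
  have ee : ∀ y : ℝ, Real.exp (-y) * Real.exp y = 1 := fun y => by
    rw [← Real.exp_add]; simp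
  set f : ℝ → ℝ := fun z => Real.exp (a * (z - m) ^ 2 - k * Real.exp z) with hf
  set g : ℝ → ℝ := fun z => -(Real.exp (-z) * f z) with hg
  set g' : ℝ → ℝ := fun z => f z * (k - (2 * a * (z - m) - 1) * Real.exp (-z)) with hg'
  have fpos : ∀ z, 0 < f z := fun z => Real.exp_pos _
  have hd : ∀ z, HasDerivAt g (g' z) z := by
    intro z
    have h1 : HasDerivAt (fun z : ℝ => a * (z - m) ^ 2 - k * Real.exp z)
        (a * (2 * (z - m)) - k * Real.exp z) z := by
      have := ((((hasDerivAt_id z).sub_const m).pow 2).const_mul a).sub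
        ((Real.hasDerivAt_exp z).const_mul k)
      refine this.congr_deriv ?_
      simp
    have h2 : HasDerivAt (fun z : ℝ => Real.exp (-z)) (-Real.exp (-z)) z := by
      simpa using (hasDerivAt_neg z).exp
    have h3 := (h2.mul h1.exp).neg
    refine h3.congr_deriv ?_
    simp only [hg', hf]
    linear_combination (k * Real.exp (a * (z - m) ^ 2 - k * Real.exp z)) * ee z
  have hlim : Filter.Tendsto g Filter.atTop (nhds 0) := by
    have : Filter.Tendsto (fun z => Real.exp (-z) * f z) Filter.atTop (nhds 0) := by
      refine squeeze_zero' (g := fun z => Real.exp (-z))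
        (Filter.Eventually.of_forall fun z => by have := fpos z; positivity) ?_ ?_
      · filter_upwards [T2.eventually (gt_mem_nhds hk)] with y hy
        have : f y ≤ 1 := by
          simp only [hf]
          rw [Real.exp_le_one_iff]
          have h1 := mul_le_mul_of_nonneg_right hy.le (Real.exp_pos y).le
          rw [mul_assoc, ee y] at h1
          linarith
        exact mul_le_of_le_one_right (Real.exp_pos _).le this
      · exact Real.tendsto_exp_neg_atTop_nhds_zero
    simpa [hg] using this.neg
  have hb : ∀ᶠ y : ℝ in Filter.atTop, (2 * a * (y - m) - 1) * Real.exp (-y) < k / 2 ∧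
      -k < (2 * a * (y - m) - 1) * Real.exp (-y) :=
    (T1.eventually (gt_mem_nhds (half_pos hk))).and
      (T1.eventually (lt_mem_nhds (neg_lt_zero.2 hk)))
  obtain ⟨N, hN⟩ := Filter.eventually_atTop.1 hb
  refine ⟨N, fun y hy => ?_⟩
  have lo : ∀ z ∈ Ioi y, f z ≤ 2 / k * g' z := by
    intro z hz
    have h := (hN z (hy.le.trans (le_of_lt hz))).1
    have := fpos z
    rw [div_mul_eq_mul_div, le_div_iff₀ hk]
    simp only [hg']
    nlinarith
  have up : ∀ z ∈ Ioi y, 1 / (2 * k) * g' z ≤ f z := by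
    intro z hz
    have h := (hN z (hy.le.trans (le_of_lt hz))).2
    have := fpos z
    rw [div_mul_eq_mul_div, div_le_iff₀ (by positivity)]
    simp only [hg']
    nlinarith
  have g'nn : ∀ z ∈ Ioi y, 0 ≤ g' z := by
    intro z hz
    have h := (hN z (hy.le.trans (le_of_lt hz))).1
    exact mul_nonneg (fpos z).le (by linarith)
  have hi : IntegrableOn g' (Ioi y) :=
    integrableOn_Ioi_deriv_of_nonneg' (fun z _ => hd z) g'nn hlim
  have hint : ∫ z in Ioi y, g' z = Real.exp (-y) * f y := by
    rw [integral_Ioi_of_hasDerivAt_of_nonneg' (fun z _ => hd z) g'nn hlim]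
    simp [hg]
  have fc : Continuous f := by fun_prop
  have fi : IntegrableOn f (Ioi y) := by
    refine Integrable.mono' (hi.const_mul (2 / k)) fc.aestronglyMeasurable ?_
    refine (ae_restrict_iff' measurableSet_Ioi).2 (Filter.Eventually.of_forall fun z hz => ?_)
    rw [Real.norm_of_nonneg (fpos z).le]
    exact lo z hz
  change (∫ z in Ici y, f z) ≤ 2 / k * (Real.exp (-y) * f y) ∧
    1 / (2 * k) * (Real.exp (-y) * f y) ≤ ∫ z in Ici y, f z
  rw [integral_Ici_eq_integral_Ioi, ← hint, ← integral_const_mul, ← integral_const_mul]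
  exact ⟨setIntegral_mono_on fi (hi.const_mul _) measurableSet_Ioi lo,
    setIntegral_mono_on (hi.const_mul _) fi measurableSet_Ioi up⟩

/-- For ρ ∈ (0,1] and c > 0, the tail integral of f_ρ is eventually bounded above by
(β/ρ) e^{−y} f_ρ(y) and eventually bounded below by (β/(4ρ)) e^{−y} f_ρ(y). -/
theorem stmt_5 (α β m c ρ : ℝ) (hα : 0 < α) (hβ : 0 < β) (hm : 0 < m) (hc : 0 < c)
    (hρ₁ : 0 < ρ) (hρ₂ : ρ ≤ 1) :
    (∃ M > c, ∀ y > M,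
      (∫ z in Ici y, Real.exp (α / β ^ 2 * (z - m) ^ 2 - 2 * ρ / β * Real.exp z)) ≤
        β / ρ * (Real.exp (-y) *
          Real.exp (α / β ^ 2 * (y - m) ^ 2 - 2 * ρ / β * Real.exp y))) ∧
    (∃ M' > c, ∀ y > M',
      β / (4 * ρ) * (Real.exp (-y) *
          Real.exp (α / β ^ 2 * (y - m) ^ 2 - 2 * ρ / β * Real.exp y)) ≤
        ∫ z in Ici y, Real.exp (α / β ^ 2 * (z - m) ^ 2 - 2 * ρ / β * Real.exp z)) := by
  obtain ⟨N, hN⟩ := aux (α / β ^ 2) (2 * ρ / β) m (by positivity)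
  have e1 : 2 / (2 * ρ / β) = β / ρ := by field_simp
  have e2 : 1 / (2 * (2 * ρ / β)) = β / (4 * ρ) := by field_simp; norm_num
  rw [e1, e2] at hN
  have hM : max N c + 1 > c := lt_of_le_of_lt (le_max_right N c) (lt_add_one _)
  have hMN : max N c + 1 > N := lt_of_le_of_lt (le_max_left N c) (lt_add_one _)
  exact ⟨⟨_, hM, fun y hy => (hN y (hMN.trans hy)).1⟩,
    ⟨_, hM, fun y hy => (hN y (hMN.trans hy)).2⟩⟩
end

section
/- Let ρ ∈ (0,1]. Then the test function value ṽ(∞) is finite; that is, ∫_c^∞ (∫_y^∞ f_ρ(z) dz) / f_ρ(y) dy < +∞. -/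
open MeasureTheory Real Set

lemma aux_K (C a d : ℝ) (hC : 0 ≤ C) (ha : 0 < a) (hd : 0 < d) :
    ∃ K : ℝ, ∀ t : ℝ, 0 ≤ t → C * t + a * t ^ 2 - d * t ^ 3 ≤ K := by
  obtain ⟨T, hT1, hT⟩ : ∃ T : ℝ, 1 ≤ T ∧ C + a ≤ d * T := by
    refine ⟨max 1 ((C + a) / d), le_max_left _ _, ?_⟩
    have := le_max_right 1 ((C + a) / d)
    rw [div_le_iff₀ hd] at this
    linarith
  refine ⟨C * T + a * T ^ 2, fun t ht => ?_⟩
  have hK : 0 ≤ C * T + a * T ^ 2 := by positivity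
  rcases le_total t T with h | h
  · have h1 : C * t ≤ C * T := by gcongr
    have h2 : a * t ^ 2 ≤ a * T ^ 2 := by gcongr
    have h3 : 0 ≤ d * t ^ 3 := by positivity
    linarith
  · have h1 : C * t ≤ C * t ^ 2 := by
      apply mul_le_mul_of_nonneg_left _ hC
      nlinarith
    have h2 : (C + a) * t ^ 2 ≤ (d * T) * t ^ 2 := by gcongr
    have h3 : (d * T) * t ^ 2 ≤ (d * t) * t ^ 2 := by gcongr
    nlinarith

lemma aux_exp (t : ℝ) (ht : 0 ≤ t) : 1 + t + t ^ 2 / 2 + t ^ 3 / 6 ≤ Real.exp t := by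
  have := Real.sum_le_exp_of_nonneg ht 4
  simp [Finset.sum_range_succ, Nat.factorial] at this
  linarith

lemma aux_main (a b m : ℝ) (ha : 0 < a) (hb : 0 < b) (hm : 0 < m) :
    ∃ K : ℝ, ∀ y z : ℝ, 0 ≤ y → y ≤ z →
      a * (z - m) ^ 2 - b * Real.exp z ≤
        (a * (y - m) ^ 2 - b * Real.exp y) + K - (b / 2 * Real.exp y) * (z - y) := by
  obtain ⟨K, hK⟩ := aux_K (4 * a ^ 2 / b) a (b / 6) (by positivity) ha (by positivity)
  refine ⟨K, fun y z hy hyz => ?_⟩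
  obtain ⟨t, rfl⟩ : ∃ t, z = y + t := ⟨z - y, by ring⟩
  have ht : 0 ≤ t := by linarith
  have h1 := hK t ht
  have h2 := aux_exp t ht
  have h3 := aux_exp y hy
  have hy3 : 0 ≤ y ^ 3 := by positivity
  have ht3 : 0 ≤ t ^ 3 := by positivity
  rw [Real.exp_add]
  set Y := Real.exp y
  have hY : y ^ 2 / 2 ≤ Y := by nlinarith
  have hY1 : 1 ≤ Y := by nlinarith
  have h4 : 2 * a * y ≤ b / 2 * Y + 4 * a ^ 2 / b := by
    have e : 4 * a ^ 2 / b + b / 4 * y ^ 2 - 2 * a * y = (2 * a - b / 2 * y) ^ 2 / b := by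
      field_simp; ring
    have : 0 ≤ (2 * a - b / 2 * y) ^ 2 / b := by positivity
    nlinarith
  have h5 : 2 * a * y * t ≤ (b / 2 * Y + 4 * a ^ 2 / b) * t := by gcongr
  have h6 : b * (Y * (1 + t + t ^ 3 / 6)) ≤ b * (Y * Real.exp t) := by
    gcongr
    nlinarith [sq_nonneg t]
  have h7 : b * (1 * (t ^ 3 / 6)) ≤ b * (Y * (t ^ 3 / 6)) := by gcongr
  have h8 : 0 ≤ 2 * a * t * m := by positivity
  nlinarith

lemma aux_int (d y A : ℝ) (hd : 0 < d) :
    IntegrableOn (fun z => A * Real.exp (-d * (z - y))) (Ici y) ∧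
    ∫ z in Ici y, A * Real.exp (-d * (z - y)) = A / d := by
  have e : (fun z => A * Real.exp (-d * (z - y))) =
      fun z => (A * Real.exp (d * y)) * Real.exp (-d * z) := by
    funext z
    rw [mul_assoc, ← Real.exp_add]
    ring_nf
  rw [e]
  constructor
  · rw [integrableOn_Ici_iff_integrableOn_Ioi]
    exact (integrableOn_exp_mul_Ioi (by linarith) y).const_mul _
  · rw [integral_Ici_eq_integral_Ioi, integral_const_mul, integral_exp_mul_Ioi (by linarith)]
    rw [neg_div_neg_eq, mul_div_assoc', mul_assoc, ← Real.exp_add]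
    simp

/-- For ρ ∈ (0,1], ṽ(∞) is finite: ∫_c^∞ (∫_y^∞ f_ρ(z) dz)/f_ρ(y) dy < +∞. -/
theorem stmt_6 (α β m c ρ : ℝ) (hα : 0 < α) (hβ : 0 < β) (hm : 0 < m) (hc : 0 < c)
    (hρ₁ : 0 < ρ) (hρ₂ : ρ ≤ 1) :
    ∫⁻ y in Ici c,
      ENNReal.ofReal
        ((∫ z in Ici y, Real.exp (α / β ^ 2 * (z - m) ^ 2 - 2 * ρ / β * Real.exp z)) /
          Real.exp (α / β ^ 2 * (y - m) ^ 2 - 2 * ρ / β * Real.exp y)) < ⊤ := by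
  have ha : 0 < α / β ^ 2 := by positivity
  have hb : 0 < 2 * ρ / β := by positivity
  generalize α / β ^ 2 = a at *
  generalize 2 * ρ / β = b at *
  obtain ⟨K, hK⟩ := aux_main a b m ha hb hm
  have hint := (aux_int 1 c (Real.exp K / (b / 2) * Real.exp (-c)) one_pos).1
  refine lt_of_le_of_lt (setLIntegral_mono' measurableSet_Ici fun y hy => ?_)
    (hint.lintegral_lt_top)
  apply ENNReal.ofReal_le_ofReal
  have hy0 : 0 ≤ y := hc.le.trans hy
  rw [div_le_iff₀ (Real.exp_pos _)]
  obtain ⟨i1, i2⟩ := aux_int (b / 2 * Real.exp y) y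
    (Real.exp (a * (y - m) ^ 2 - b * Real.exp y) * Real.exp K) (by positivity)
  refine le_trans (integral_mono_of_nonneg (Filter.Eventually.of_forall fun z => (Real.exp_pos _).le)
    i1 ?_) (i2.trans ?_).le
  · refine (ae_restrict_iff' measurableSet_Ici).2 (Filter.Eventually.of_forall fun z hz => ?_)
    simp only
    rw [← Real.exp_add, ← Real.exp_add]
    apply Real.exp_le_exp.2
    have := hK y z hy0 hz
    linarith
  · have : Real.exp (-c) * Real.exp (-1 * (y - c)) = (Real.exp y)⁻¹ := by
      rw [← Real.exp_add, ← Real.exp_neg]; ring_nf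
    rw [mul_assoc (Real.exp K / (b / 2)), this]
    field_simp
end

section
/- For every ρ ∈ [−1,1], the iterated integral in the extended nonnegative reals ∫_c^∞ e^{2y} (∫_y^∞ f_ρ(z) dz)/f_ρ(y) dy equals +∞ (for ρ ≤ 0 the inner integral is already +∞ for every y, and for ρ > 0 the outer integral diverges). In particular ṽ_b(∞) = +∞ for all correlations ρ ∈ [−1,1]. -/
open MeasureTheory Real Set

/-- For every ρ ∈ [−1,1], the iterated integral in [0,∞]
∫_c^∞ e^{2y} (∫_y^∞ f_ρ(z) dz)/f_ρ(y) dy equals +∞, i.e. ṽ_b(∞) = +∞. -/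
theorem stmt_8 (α β m c ρ : ℝ) (hα : 0 < α) (hβ : 0 < β) (hm : 0 < m) (hc : 0 < c)
    (hρ₁ : -1 ≤ ρ) (hρ₂ : ρ ≤ 1) :
    ∫⁻ y in Ici c,
      ENNReal.ofReal (Real.exp (2 * y)) *
        (∫⁻ z in Ici y,
          ENNReal.ofReal (Real.exp (α / β ^ 2 * (z - m) ^ 2 - 2 * ρ / β * Real.exp z))) /
        ENNReal.ofReal (Real.exp (α / β ^ 2 * (y - m) ^ 2 - 2 * ρ / β * Real.exp y)) = ⊤ := by
  set g : ℝ → ℝ := fun z => α / β ^ 2 * (z - m) ^ 2 - 2 * ρ / β * Real.exp z with hg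
  change ∫⁻ y in Ici c, ENNReal.ofReal (Real.exp (2 * y)) *
        (∫⁻ z in Ici y, ENNReal.ofReal (Real.exp (g z))) / ENNReal.ofReal (Real.exp (g y)) = ⊤
  have key : ∀ y ∈ Ici (max c m), ENNReal.ofReal (Real.exp (-(4 / β))) ≤
      ENNReal.ofReal (Real.exp (2 * y)) *
        (∫⁻ z in Ici y, ENNReal.ofReal (Real.exp (g z))) / ENNReal.ofReal (Real.exp (g y)) := by
    intro y hy
    have hy' : max c m ≤ y := hy
    have hym : m ≤ y := (le_max_right _ _).trans hy'
    have hy0 : 0 < y := hm.trans_le hym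
    have hpt : ∀ z ∈ Icc y (y + Real.exp (-y)), g y - 4 / β ≤ g z := by
      intro z hz
      obtain ⟨h1, h2⟩ := hz
      have hle1 : Real.exp (-y) ≤ 1 := Real.exp_le_one_iff.mpr (by linarith)
      have hE : Real.exp z - Real.exp y ≤ 2 := by
        have h3 := Real.abs_exp_sub_one_le (x := z - y) (by rw [abs_le]; constructor <;> linarith)
        rw [abs_of_nonneg (by linarith : 0 ≤ z - y)] at h3
        have h4 := (abs_le.mp h3).2
        have h5 : Real.exp z = Real.exp y * Real.exp (z - y) := by
          rw [← Real.exp_add]; ring_nf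
        have h6 : Real.exp y * Real.exp (-y) = 1 := by
          rw [← Real.exp_add]; simp
        have h7 : Real.exp (z - y) - 1 ≤ 2 * Real.exp (-y) := by linarith
        have h8 := mul_le_mul_of_nonneg_left h7 (Real.exp_pos y).le
        nlinarith
      have hE0 : 0 ≤ Real.exp z - Real.exp y := sub_nonneg.mpr (Real.exp_le_exp.mpr h1)
      have hq : α / β ^ 2 * (y - m) ^ 2 ≤ α / β ^ 2 * (z - m) ^ 2 := by
        apply mul_le_mul_of_nonneg_left _ (by positivity)
        apply pow_le_pow_left₀ <;> linarith
      have hr : 2 * ρ / β * (Real.exp z - Real.exp y) ≤ 4 / β := by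
        have h9 : ρ * (Real.exp z - Real.exp y) ≤ 2 := by nlinarith
        have : 2 * ρ / β * (Real.exp z - Real.exp y)
          = 2 * (ρ * (Real.exp z - Real.exp y)) / β := by ring
        rw [this]
        apply div_le_div_of_nonneg_right _ hβ.le
        linarith
      simp only [hg]
      linarith
    have hI : ENNReal.ofReal (Real.exp (g y - 4 / β)) * ENNReal.ofReal (Real.exp (-y)) ≤
        ∫⁻ z in Ici y, ENNReal.ofReal (Real.exp (g z)) := by
      calc _ = ∫⁻ z in Icc y (y + Real.exp (-y)), ENNReal.ofReal (Real.exp (g y - 4 / β)) := by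
            rw [setLIntegral_const, Real.volume_Icc]; simp
        _ ≤ ∫⁻ z in Icc y (y + Real.exp (-y)), ENNReal.ofReal (Real.exp (g z)) :=
            setLIntegral_mono' measurableSet_Icc fun z hz =>
              ENNReal.ofReal_le_ofReal (Real.exp_le_exp.mpr (hpt z hz))
        _ ≤ _ := lintegral_mono_set Icc_subset_Ici_self
    rw [ENNReal.le_div_iff_mul_le (Or.inl (by simp [Real.exp_pos])) (Or.inl (by simp))]
    refine le_trans ?_ (mul_le_mul_right hI _)
    rw [← ENNReal.ofReal_mul (Real.exp_pos _).le, ← ENNReal.ofReal_mul (Real.exp_pos _).le,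
      ← ENNReal.ofReal_mul (Real.exp_pos _).le, ← Real.exp_add, ← Real.exp_add, ← Real.exp_add]
    apply ENNReal.ofReal_le_ofReal
    apply Real.exp_le_exp.mpr
    linarith
  rw [eq_top_iff]
  calc ⊤ = ∫⁻ y in Ici (max c m), ENNReal.ofReal (Real.exp (-(4 / β))) := by
        rw [setLIntegral_const, Real.volume_Ici, ENNReal.mul_top]
        simp [Real.exp_pos]
    _ ≤ _ := setLIntegral_mono' measurableSet_Ici key
    _ ≤ _ := lintegral_mono_set (Ici_subset_Ici.mpr (le_max_left _ _))
end
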